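/- For every N ≥ 2 there exist analytic maps Φ₁, Φ₂: D^N → D^N with Φ₁(D^N) = Φ₂(D^N) such that C_{Φ₁} is compact on H²(D^N) with β_N(C_{Φ₁}) = 1, while C_{Φ₂} is compact on H²(D^N) with β_N(C_{Φ₂}) = 0. -/

import Mathlib

open Complex MeasureTheory Set Filter
open scoped ENNReal Topology

noncomputable section

/-- The open unit disk in `ℂ`. -/
def unitDisk : Set ℂ := Metric.ball (0 : ℂ) 1

/-- A symbol: a non-constant analytic self-map of the unit disk. -/
structure IsSymbol (φ : ℂ → ℂ) : Prop where
  mapsTo : Set.MapsTo φ unitDisk unitDisk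
  diff : DifferentiableOn ℂ φ unitDisk
  nonconst : ¬ ∃ c : ℂ, Set.EqOn φ (fun _ => c) unitDisk

/-- `φ` is `p`-valent: every `w ∈ 𝔻` has at most `p` preimages in `𝔻`. -/
def Valent (φ : ℂ → ℂ) (p : ℕ) : Prop :=
  ∀ w ∈ unitDisk, (unitDisk ∩ φ ⁻¹' {w}).encard ≤ p

/-- The radial limit of `φ` at the boundary point `toCircle θ` exists and equals `w`.
The circle `𝕋` is parametrized by `AddCircle 1` (so that `volume` is the normalized
Haar measure `m`). -/
def HasRadialLimit (φ : ℂ → ℂ) (θ : AddCircle (1 : ℝ)) (w : ℂ) : Prop :=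
  Filter.Tendsto (fun r : ℝ => φ (r * (AddCircle.toCircle θ : ℂ)))
    (nhdsWithin 1 (Set.Iio 1)) (nhds w)

/-- The pull-back measure `m_φ(S) = m({ξ : φ*(ξ) ∈ S})`. -/
def pullbackMeasure (φ : ℂ → ℂ) (S : Set ℂ) : ℝ≥0∞ :=
  volume {θ : AddCircle (1 : ℝ) | ∃ w ∈ S, HasRadialLimit φ θ w}

/-- `ρ_φ(h) = sup_{ξ ∈ 𝕋} m_φ[S(ξ,h)]`, where `S(ξ,h) = {z : |z - ξ| ≤ h}`. -/
def rho (φ : ℂ → ℂ) (h : ℝ) : ℝ≥0∞ :=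
  ⨆ ξ : Circle, pullbackMeasure φ {z : ℂ | ‖z - (ξ : ℂ)‖ ≤ h}

/-- The `n`-th approximation number of a bounded operator between normed spaces:
the distance of `T` to operators of rank `< n`. -/
def approxNum {E F : Type*} [NormedAddCommGroup E] [NormedAddCommGroup F]
    [NormedSpace ℂ E] [NormedSpace ℂ F] (n : ℕ) (T : E →L[ℂ] F) : ℝ :=
  sInf {c : ℝ | ∃ R : E →L[ℂ] F,
    Module.rank ℂ (LinearMap.range (R : E →ₗ[ℂ] F)) < (n : Cardinal) ∧ c = ‖T - R‖}

/-- The Hardy space `H²(𝔻)` in its coefficient model `ℓ²(ℕ)`. -/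
abbrev H2 := lp (fun _ : ℕ => ℂ) 2

/-- The analytic function on `𝔻` associated with an element of `H²`. -/
def H2.eval (a : H2) (z : ℂ) : ℂ := ∑' n : ℕ, a n * z ^ n

/-- `T` is the composition operator with symbol `φ` on `H²(𝔻)`. -/
def IsCompOp (φ : ℂ → ℂ) (T : H2 →L[ℂ] H2) : Prop :=
  ∀ a : H2, ∀ z ∈ unitDisk, H2.eval (T a) z = H2.eval a (φ z)

/-- The open unit polydisk `𝔻^N`. -/
def polyDisk (N : ℕ) : Set (Fin N → ℂ) := {z | ∀ i, ‖z i‖ < 1}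

/-- The Hardy space `H²(𝔻^N)` in its coefficient model `ℓ²(ℕ^N)`. -/
abbrev H2poly (N : ℕ) := lp (fun _ : Fin N → ℕ => ℂ) 2

/-- The analytic function on `𝔻^N` associated with an element of `H²(𝔻^N)`. -/
def H2poly.eval {N : ℕ} (a : H2poly N) (z : Fin N → ℂ) : ℂ :=
  ∑' α : Fin N → ℕ, a α * ∏ i, z i ^ α i

/-- `T` is the composition operator with symbol `Φ` on `H²(𝔻^N)`. -/
def IsCompOpPoly {N : ℕ} (Φ : (Fin N → ℂ) → (Fin N → ℂ))
    (T : H2poly N →L[ℂ] H2poly N) : Prop :=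
  ∀ a : H2poly N, ∀ z ∈ polyDisk N, H2poly.eval (T a) z = H2poly.eval a (Φ z)

/-- The lens map `λ_θ`. -/
def lens (θ : ℝ) (z : ℂ) : ℂ :=
  ((1 + z) ^ (θ : ℂ) - (1 - z) ^ (θ : ℂ)) / ((1 + z) ^ (θ : ℂ) + (1 - z) ^ (θ : ℂ))

lemma hasSum_norm_sq_lp {κ : Type*} (a : lp (fun _ : κ => ℂ) 2) :
    HasSum (fun i => ‖a i‖ ^ 2) (‖a‖ ^ 2) := by
  simpa using lp.hasSum_norm (p := 2) (by simp) a

lemma memlp_two_of_summable {κ : Type*} {f : κ → ℂ} (h : Summable fun i => ‖f i‖ ^ 2) :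
    Memℓp f 2 :=
  memℓp_gen (by simpa using h)

/-- The multi-index `(k, j, 0, …, 0)`. -/
def multiIndex (m : ℕ) (x : ℕ × ℕ) : Fin (m + 2) → ℕ :=
  Fin.cons x.1 (Fin.cons x.2 0)

lemma multiIndex_injective (m : ℕ) : Function.Injective (multiIndex m) := by
  intro x y h
  have h0 := congrFun h 0
  have h1 := congrFun h 1
  simp only [multiIndex, Fin.cons_zero, Fin.cons_one] at h0 h1
  exact Prod.ext h0 h1

lemma prod_pow_multiIndex {m : ℕ} (z : Fin (m + 2) → ℂ) (x : ℕ × ℕ) :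
    ∏ i, z i ^ multiIndex m x i = z 0 ^ x.1 * z 1 ^ x.2 := by
  simp [multiIndex, Fin.prod_univ_succ]

/-- `v` is obtained from `a` by replacing each monomial `z₀ ^ k` by
`z₀ ^ k * ∑ j, c k j * z₁ ^ j` and dropping the other monomials. -/
def IsWeighted {m : ℕ} (c : ℕ → ℕ → ℝ) (a v : H2poly (m + 2)) : Prop :=
  (∀ x, v (multiIndex m x) = a (multiIndex m (x.1, 0)) * c x.1 x.2) ∧
    ∀ β ∉ Set.range (multiIndex m), v β = 0

lemma summable_coeff_axis {m : ℕ} (a : H2poly (m + 2)) :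
    Summable fun k => ‖a (multiIndex m (k, 0))‖ ^ 2 :=
  (hasSum_norm_sq_lp a).summable.comp_injective
    (i := fun k => multiIndex m (k, 0))
    fun _ _ h => congrArg Prod.fst (multiIndex_injective m h)

lemma tsum_coeff_axis_le {m : ℕ} (a : H2poly (m + 2)) :
    ∑' k, ‖a (multiIndex m (k, 0))‖ ^ 2 ≤ ‖a‖ ^ 2 := by
  rw [← (hasSum_norm_sq_lp a).tsum_eq]
  exact tsum_comp_le_tsum_of_inj (hasSum_norm_sq_lp a).summable
    (fun _ => by positivity) (i := fun k => multiIndex m (k, 0))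
    fun _ _ h => congrArg Prod.fst (multiIndex_injective m h)

lemma summable_weighted {m : ℕ} {c : ℕ → ℕ → ℝ} {σ : ℕ → ℝ} {B : ℝ}
    (hσ : ∀ k, HasSum (fun j => c k j ^ 2) (σ k)) (hB : ∀ k, σ k ≤ B) (a : H2poly (m + 2)) :
    Summable fun x : ℕ × ℕ => ‖a (multiIndex m (x.1, 0)) * c x.1 x.2‖ ^ 2 := by
  have key : ∀ k j, ‖a (multiIndex m (k, 0)) * c k j‖ ^ 2
      = ‖a (multiIndex m (k, 0))‖ ^ 2 * c k j ^ 2 := fun k j => by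
    rw [norm_mul, mul_pow, Complex.norm_real, Real.norm_eq_abs, sq_abs]
  rw [summable_prod_of_nonneg fun _ => by positivity]
  simp only [key, tsum_mul_left, (hσ _).tsum_eq]
  refine ⟨fun k => (hσ k).summable.mul_left _, ?_⟩
  have h0 : ∀ k, 0 ≤ σ k := fun k => (hσ k).nonneg fun _ => by positivity
  exact Summable.of_nonneg_of_le (fun k => mul_nonneg (by positivity) (h0 k))
    (fun k => mul_le_mul_of_nonneg_left (hB k) (by positivity))
    ((summable_coeff_axis a).mul_right B)

lemma IsWeighted.hasSum {m : ℕ} {c : ℕ → ℕ → ℝ} {σ : ℕ → ℝ} {a v : H2poly (m + 2)}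
    (h : IsWeighted c a v) (hσ : ∀ k, HasSum (fun j => c k j ^ 2) (σ k)) :
    HasSum (fun k => ‖a (multiIndex m (k, 0))‖ ^ 2 * σ k) (‖v‖ ^ 2) := by
  have h1 := hasSum_norm_sq_lp v
  rw [← (multiIndex_injective m).hasSum_iff (fun β hβ => by simp [h.2 β hβ])] at h1
  refine h1.prod_fiberwise fun k => ?_
  simpa [Function.comp_def, h.1, mul_pow] using (hσ k).mul_left (‖a (multiIndex m (k, 0))‖ ^ 2)

lemma IsWeighted.norm_sq_le {m : ℕ} {c : ℕ → ℕ → ℝ} {σ : ℕ → ℝ} {B : ℝ} {a v : H2poly (m + 2)}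
    (h : IsWeighted c a v) (hσ : ∀ k, HasSum (fun j => c k j ^ 2) (σ k)) (hB : ∀ k, σ k ≤ B) :
    ‖v‖ ^ 2 ≤ B * ‖a‖ ^ 2 := by
  have hB0 : 0 ≤ B := ((hσ 0).nonneg fun _ => by positivity).trans (hB 0)
  rw [← (h.hasSum hσ).tsum_eq]
  calc _ ≤ ∑' k, B * ‖a (multiIndex m (k, 0))‖ ^ 2 :=
        (h.hasSum hσ).summable.tsum_le_tsum
          (fun k => by rw [mul_comm]; exact mul_le_mul_of_nonneg_right (hB k) (by positivity))
          ((summable_coeff_axis a).mul_left B)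
    _ ≤ _ := by
        rw [tsum_mul_left]
        exact mul_le_mul_of_nonneg_left (tsum_coeff_axis_le a) hB0

lemma exists_weightedOp {m : ℕ} {c : ℕ → ℕ → ℝ} {σ : ℕ → ℝ}
    (hσ : ∀ k, HasSum (fun j => c k j ^ 2) (σ k)) (h1 : ∀ k, σ k ≤ 1) :
    ∃ T : H2poly (m + 2) →L[ℂ] H2poly (m + 2), ∀ a, IsWeighted c a (T a) := by
  have hinj := multiIndex_injective m
  let f : H2poly (m + 2) → (Fin (m + 2) → ℕ) → ℂ := fun a =>
    Function.extend (multiIndex m) (fun x => a (multiIndex m (x.1, 0)) * c x.1 x.2) 0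
  have hf : ∀ a x, f a (multiIndex m x) = a (multiIndex m (x.1, 0)) * c x.1 x.2 :=
    fun a x => hinj.extend_apply _ _ _
  have hf0 : ∀ a, ∀ β ∉ Set.range (multiIndex m), f a β = 0 :=
    fun a β hβ => Function.extend_apply' _ _ _ hβ
  have hmem : ∀ a, Memℓp (f a) 2 := fun a => memlp_two_of_summable <| by
    rw [← hinj.summable_iff (fun β hβ => by simp [hf0 a β hβ])]
    simpa only [Function.comp_def, hf] using summable_weighted hσ h1 a
  let L : H2poly (m + 2) →ₗ[ℂ] H2poly (m + 2) :=
    { toFun := fun a => ⟨f a, hmem a⟩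
      map_add' := fun a b => by
        ext β
        by_cases hβ : β ∈ Set.range (multiIndex m)
        · obtain ⟨x, rfl⟩ := hβ
          change f _ _ = f _ _ + f _ _
          simp [hf, add_mul]
        · change f _ _ = f _ _ + f _ _
          simp [hf0 _ β hβ]
      map_smul' := fun r a => by
        ext β
        by_cases hβ : β ∈ Set.range (multiIndex m)
        · obtain ⟨x, rfl⟩ := hβ
          change f _ _ = r * f _ _
          simp [hf, mul_assoc]
        · change f _ _ = r * f _ _
          simp [hf0 _ β hβ] }
  have hL : ∀ a, IsWeighted c a (L a) := fun a => ⟨hf a, hf0 a⟩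
  exact ⟨L.mkContinuous 1 fun a =>
    pow_le_pow_iff_left₀ (norm_nonneg _) (by positivity) two_ne_zero |>.mp (by simpa using (hL a).norm_sq_le hσ h1), hL⟩

/-- The embedding of `ℂⁿ` as the span of `1, z₀, …, z₀ ^ (n - 1)`. -/
def axisEmb (m n : ℕ) : (Fin n → ℂ) →ₗ[ℂ] H2poly (m + 2) :=
  ∑ k : Fin n, (LinearMap.proj k : (Fin n → ℂ) →ₗ[ℂ] ℂ).smulRight
    (lp.single 2 (multiIndex m (k, 0)) (1 : ℂ))

lemma axisEmb_apply {m n : ℕ} (x : Fin n → ℂ) (k : ℕ) :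
    axisEmb m n x (multiIndex m (k, 0)) = if h : k < n then x ⟨k, h⟩ else 0 := by
  have key : ∀ i : Fin n, (lp.single 2 (multiIndex m (i, 0)) (1 : ℂ) : H2poly (m + 2))
      (multiIndex m (k, 0)) = if k = i then 1 else 0 := fun i => by
    rw [lp.single_apply]
    simp [Pi.single_apply, (multiIndex_injective m).eq_iff]
  simp only [axisEmb, LinearMap.sum_apply, LinearMap.smulRight_apply, LinearMap.proj_apply]
  rw [lp.coeFn_sum, Finset.sum_apply]
  simp only [lp.coeFn_smul, Pi.smul_apply, key, smul_eq_mul, mul_ite, mul_one, mul_zero]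
  split_ifs with h
  · rw [Finset.sum_eq_single ⟨k, h⟩] <;> simp
    exact fun b hb hk => absurd (Fin.ext hk.symm) hb
  · exact Finset.sum_eq_zero fun i _ => if_neg fun hk : k = i => h (hk ▸ i.2)

lemma axisEmb_norm_sq {m n : ℕ} (x : Fin n → ℂ) : ‖axisEmb m n x‖ ^ 2 = ∑ k, ‖x k‖ ^ 2 := by
  have h := hasSum_norm_sq_lp (axisEmb m n x)
  have hinj : Function.Injective fun k => multiIndex m (k, 0) :=
    fun _ _ h => congrArg Prod.fst (multiIndex_injective m h)
  have hz : ∀ β ∉ Set.range (fun k => multiIndex m (k, 0)),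
      ‖axisEmb m n x β‖ ^ 2 = 0 := fun β hβ => by
    simp only [axisEmb, LinearMap.sum_apply, LinearMap.smulRight_apply, LinearMap.proj_apply]
    rw [lp.coeFn_sum, Finset.sum_apply, Finset.sum_eq_zero, norm_zero, zero_pow two_ne_zero]
    intro i _
    rw [lp.coeFn_smul, Pi.smul_apply, lp.single_apply_ne, smul_zero]
    exact fun hi => hβ ⟨i, hi.symm⟩
  rw [← hinj.hasSum_iff hz] at h
  refine h.unique ?_
  simp only [Function.comp_def, axisEmb_apply]
  have hs : ∑ k, ‖x k‖ ^ 2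
      = ∑ k ∈ Finset.range n, ‖if h : k < n then x ⟨k, h⟩ else 0‖ ^ 2 := by
    rw [← Fin.sum_univ_eq_sum_range (fun k => ‖if h : k < n then x ⟨k, h⟩ else 0‖ ^ 2)]
    simp
  rw [hs]
  exact hasSum_sum_of_ne_finset_zero fun k hk => by
    rw [dif_neg (by simpa using hk), norm_zero, zero_pow two_ne_zero]

/-- The first `n` Taylor coefficients in the variable `z₀`. -/
def axisProj (m n : ℕ) : H2poly (m + 2) →L[ℂ] (Fin n → ℂ) :=
  ContinuousLinearMap.pi fun k => lp.evalCLM ℂ (fun _ => ℂ) 2 (multiIndex m (k, 0))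

lemma axisProj_apply {m n : ℕ} (a : H2poly (m + 2)) (k : Fin n) :
    axisProj m n a k = a (multiIndex m (k, 0)) := rfl

/-- The restriction of `T` to the span of `1, z₀, …, z₀ ^ (n - 1)`. -/
def truncate {m : ℕ} (n : ℕ) (T : H2poly (m + 2) →L[ℂ] H2poly (m + 2)) :
    H2poly (m + 2) →L[ℂ] H2poly (m + 2) :=
  (T ∘L (axisEmb m n).toContinuousLinearMap) ∘L axisProj m n

lemma isCompactOperator_truncate {m n : ℕ} (T : H2poly (m + 2) →L[ℂ] H2poly (m + 2)) :
    IsCompactOperator (truncate n T) :=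
  ((isCompactOperator_id (E := Fin n → ℂ)).clm_comp
    (T ∘L (axisEmb m n).toContinuousLinearMap)).comp_clm (axisProj m n)

lemma rank_truncate_lt {m n : ℕ} (T : H2poly (m + 2) →L[ℂ] H2poly (m + 2)) :
    Module.rank ℂ (LinearMap.range (truncate n T : H2poly (m + 2) →ₗ[ℂ] H2poly (m + 2)))
      < ((n + 1 : ℕ) : Cardinal) := by
  have h : Module.rank ℂ (LinearMap.range (truncate n T : H2poly (m + 2) →ₗ[ℂ] H2poly (m + 2)))
      ≤ n := by
    refine (Submodule.rank_mono (t := LinearMap.range ((T : H2poly (m + 2) →ₗ[ℂ] H2poly (m + 2)) ∘ₗ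
      axisEmb m n)) ?_).trans ?_
    · rintro _ ⟨a, rfl⟩
      exact ⟨axisProj m n a, rfl⟩
    · simpa using rank_range_le ((T : H2poly (m + 2) →ₗ[ℂ] H2poly (m + 2)) ∘ₗ axisEmb m n)
  exact h.trans_lt (by exact_mod_cast n.lt_succ_self)

lemma norm_sub_truncate_le {m n : ℕ} {c : ℕ → ℕ → ℝ} {σ : ℕ → ℝ} {B : ℝ}
    (hσ : ∀ k, HasSum (fun j => c k j ^ 2) (σ k)) (hB0 : 0 ≤ B) (hB : ∀ k, n ≤ k → σ k ≤ B ^ 2)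
    {T : H2poly (m + 2) →L[ℂ] H2poly (m + 2)} (hT : ∀ a, IsWeighted c a (T a)) :
    ‖T - truncate n T‖ ≤ B := by
  refine ContinuousLinearMap.opNorm_le_bound _ hB0 fun a => ?_
  refine pow_le_pow_iff_left₀ (norm_nonneg _) (by positivity) two_ne_zero |>.mp ?_
  rw [mul_pow]
  have htr : truncate n T a = T (axisEmb m n (axisProj m n a)) := rfl
  refine IsWeighted.norm_sq_le (c := fun k j => if k < n then 0 else c k j)
    (σ := fun k => if k < n then 0 else σ k) ⟨fun x => ?_, fun β hβ => ?_⟩ (fun k => ?_)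
    fun k => ?_
  · rw [_root_.sub_apply, lp.coeFn_sub, Pi.sub_apply, htr, (hT _).1, (hT _).1,
      axisEmb_apply]
    split_ifs with h <;> simp [axisProj_apply, h]
  · rw [_root_.sub_apply, lp.coeFn_sub, Pi.sub_apply, htr, (hT _).2 β hβ,
      (hT _).2 β hβ, sub_zero]
  · by_cases h : k < n
    · simp [h]
    · simpa [h] using hσ k
  · split_ifs with h
    · positivity
    · exact hB k (not_lt.mp h)

lemma isCompactOperator_of_weighted {m : ℕ} {c : ℕ → ℕ → ℝ} {σ : ℕ → ℝ}
    (hσ : ∀ k, HasSum (fun j => c k j ^ 2) (σ k)) (h0 : Tendsto σ atTop (𝓝 0))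
    {T : H2poly (m + 2) →L[ℂ] H2poly (m + 2)} (hT : ∀ a, IsWeighted c a (T a)) :
    IsCompactOperator T := by
  refine isCompactOperator_of_tendsto (F := fun n => truncate n T) (l := atTop) ?_
    (Eventually.of_forall fun n => isCompactOperator_truncate T)
  rw [tendsto_iff_norm_sub_tendsto_zero, Metric.tendsto_atTop]
  intro ε hε
  obtain ⟨K, hK⟩ := eventually_atTop.mp
    (h0.eventually (eventually_le_nhds (show (0 : ℝ) < (ε / 2) ^ 2 by positivity)))
  refine ⟨K, fun n hn => ?_⟩
  rw [Real.dist_eq, sub_zero, abs_norm, norm_sub_rev]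
  have := norm_sub_truncate_le hσ (by positivity) (fun k hk => hK k (hn.trans hk)) hT
  linarith

section approxNum

variable {E F : Type*} [NormedAddCommGroup E] [NormedAddCommGroup F]
  [NormedSpace ℂ E] [NormedSpace ℂ F]

lemma approxNum_nonneg (n : ℕ) (T : E →L[ℂ] F) : 0 ≤ approxNum n T :=
  Real.sInf_nonneg (by rintro _ ⟨R, -, rfl⟩; exact norm_nonneg _)

lemma approxNum_le {n : ℕ} {T R : E →L[ℂ] F}
    (hR : Module.rank ℂ (LinearMap.range (R : E →ₗ[ℂ] F)) < (n : Cardinal)) :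
    approxNum n T ≤ ‖T - R‖ :=
  csInf_le ⟨0, by rintro _ ⟨R, -, rfl⟩; exact norm_nonneg _⟩ ⟨R, hR, rfl⟩

/-- An operator bounded below on an `n`-dimensional space has a large `n`-th
approximation number. -/
lemma le_approxNum {n : ℕ} (hn : 0 < n) {T : E →L[ℂ] F} {B : ℝ} (J : (Fin n → ℂ) →ₗ[ℂ] E)
    (hJ : ∀ x, J x = 0 → x = 0) (hB : ∀ x, B * ‖J x‖ ≤ ‖T (J x)‖) : B ≤ approxNum n T := by
  refine le_csInf ⟨_, 0, ?_, rfl⟩ ?_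
  · simpa [LinearMap.range_zero] using hn
  rintro _ ⟨R, hR, rfl⟩
  obtain ⟨x, hx0, hx⟩ : ∃ x, x ≠ 0 ∧ R (J x) = 0 := by
    by_contra! hcon
    refine hR.not_ge (Module.le_rank_iff_exists_linearMap.mpr
      ⟨((R : E →ₗ[ℂ] F) ∘ₗ J).codRestrict _ fun x => ⟨J x, rfl⟩, ?_⟩)
    rw [injective_iff_map_eq_zero]
    intro x hx
    by_contra hne
    exact hcon x hne (congrArg Subtype.val hx)
  have hpos : 0 < ‖J x‖ := norm_pos_iff.mpr fun h => hx0 (hJ x h)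
  refine le_of_mul_le_mul_right ?_ hpos
  calc B * ‖J x‖ ≤ ‖T (J x)‖ := hB x
    _ = ‖(T - R) (J x)‖ := by simp [hx]
    _ ≤ _ := (T - R).le_opNorm _

end approxNum

lemma le_approxNum_of_weighted {m n : ℕ} {c : ℕ → ℕ → ℝ} {σ : ℕ → ℝ} {B : ℝ}
    (hσ : ∀ k, HasSum (fun j => c k j ^ 2) (σ k)) (hB : ∀ k ≤ n, B ^ 2 ≤ σ k)
    {T : H2poly (m + 2) →L[ℂ] H2poly (m + 2)} (hT : ∀ a, IsWeighted c a (T a)) :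
    B ≤ approxNum (n + 1) T := by
  refine le_approxNum n.succ_pos (axisEmb m (n + 1)) (fun x hx => ?_) fun x => ?_
  · ext k
    have := axisEmb_apply (m := m) x k
    rw [hx, dif_pos k.2] at this
    exact this.symm
  · refine le_of_sq_le_sq ?_ (norm_nonneg _)
    rw [mul_pow, axisEmb_norm_sq, Finset.mul_sum]
    refine le_trans ?_ (sum_le_hasSum (Finset.range (n + 1)) (fun k _ => ?_)
      ((hT (axisEmb m (n + 1) x)).hasSum hσ))
    · rw [← Fin.sum_univ_eq_sum_range
        (fun k => ‖axisEmb m (n + 1) x (multiIndex m (k, 0))‖ ^ 2 * σ k)]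
      refine Finset.sum_le_sum fun k _ => ?_
      rw [axisEmb_apply, dif_pos k.2, mul_comm]
      exact mul_le_mul_of_nonneg_left (hB k (Nat.lt_succ_iff.mp k.2)) (by positivity)
    · exact mul_nonneg (by positivity) ((hσ k).nonneg fun _ => by positivity)

/-- The numbers `c k j ≥ 0` are the Taylor coefficients of the powers `g ^ k` of an analytic
function `g` on the disk with `g(1⁻) = 1`. -/
structure IsPowerCoeff (g : ℂ → ℂ) (c : ℕ → ℕ → ℝ) : Prop where
  diff : DifferentiableOn ℂ g unitDisk
  nonneg : ∀ k j, 0 ≤ c k j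
  sum_one : ∀ k, HasSum (c k) 1
  hasSum : ∀ k, ∀ w ∈ unitDisk, HasSum (fun j => (c k j : ℂ) * w ^ j) (g w ^ k)

/-- The symbol `z ↦ (z₀ * g z₁, 0, …, 0)`. -/
def axisSymbol (m : ℕ) (g : ℂ → ℂ) (z : Fin (m + 2) → ℂ) : Fin (m + 2) → ℂ :=
  Pi.single 0 (z 0 * g (z 1))

lemma mem_unitDisk {w : ℂ} : w ∈ unitDisk ↔ ‖w‖ < 1 := by simp [unitDisk]

namespace IsPowerCoeff

variable {g : ℂ → ℂ} {c : ℕ → ℕ → ℝ}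

lemma le_one (h : IsPowerCoeff g c) (k j : ℕ) : c k j ≤ 1 :=
  le_hasSum (h.sum_one k) j fun i _ => h.nonneg k i

lemma norm_le_one (h : IsPowerCoeff g c) {w : ℂ} (hw : w ∈ unitDisk) : ‖g w‖ ≤ 1 := by
  have h1 := h.hasSum 1 w hw
  rw [pow_one] at h1
  rw [← h1.tsum_eq]
  refine tsum_of_norm_bounded (h.sum_one 1) fun j => ?_
  rw [norm_mul, Complex.norm_real, Real.norm_of_nonneg (h.nonneg 1 j), norm_pow]
  exact mul_le_of_le_one_right (h.nonneg 1 j)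
    (pow_le_one₀ (norm_nonneg _) (mem_unitDisk.mp hw).le)

lemma exists_norm_gt (h : IsPowerCoeff g c) {r : ℝ} (hr : r < 1) :
    ∃ w ∈ unitDisk, r < ‖g w‖ := by
  obtain ⟨M, hM⟩ := ((h.sum_one 1).tendsto_sum_nat.eventually (lt_mem_nhds hr)).exists
  have hcont : Tendsto (fun t : ℝ => ∑ j ∈ Finset.range M, c 1 j * t ^ j) (𝓝[<] 1)
      (𝓝 (∑ j ∈ Finset.range M, c 1 j * 1 ^ j)) :=
    ((by fun_prop : Continuous fun t : ℝ => ∑ j ∈ Finset.range M, c 1 j * t ^ j).tendsto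
      1).mono_left nhdsWithin_le_nhds
  simp only [one_pow, mul_one] at hcont
  obtain ⟨t, hrt, ht0, ht1⟩ := ((hcont.eventually (lt_mem_nhds hM)).and
    (Ioo_mem_nhdsLT (show (0 : ℝ) < 1 by norm_num))).exists
  have htd : (t : ℂ) ∈ unitDisk := by
    rw [mem_unitDisk, Complex.norm_real, Real.norm_of_nonneg ht0.le]; exact ht1
  refine ⟨t, htd, hrt.trans_le ?_⟩
  have hs := h.hasSum 1 t htd
  rw [pow_one] at hs
  have hre := Complex.hasSum_re hs
  have hcoe : ∀ j, ((c 1 j : ℂ) * (t : ℂ) ^ j).re = c 1 j * t ^ j := fun j => by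
    rw [← Complex.ofReal_pow, ← Complex.ofReal_mul, Complex.ofReal_re]
  simp only [hcoe] at hre
  exact (sum_le_hasSum _ (fun j _ => mul_nonneg (h.nonneg 1 j) (pow_nonneg ht0.le j)) hre).trans
    (Complex.re_le_norm _)

lemma hasSum_sq (h : IsPowerCoeff g c) (k : ℕ) :
    HasSum (fun j => c k j ^ 2) (∑' j, c k j ^ 2) :=
  (Summable.of_nonneg_of_le (fun _ => by positivity)
    (fun j => pow_le_of_le_one (h.nonneg k j) (h.le_one k j) two_ne_zero)
    (h.sum_one k).summable).hasSum

lemma tsum_sq_le (h : IsPowerCoeff g c) {k : ℕ} {b : ℝ} (hb : ∀ j, c k j ≤ b) :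
    ∑' j, c k j ^ 2 ≤ b := by
  have h2 := (h.sum_one k).mul_left b
  rw [mul_one] at h2
  refine hasSum_le (fun j => ?_) (h.hasSum_sq k) h2
  rw [sq]
  exact mul_le_mul_of_nonneg_right (hb j) (h.nonneg k j)

lemma norm_axisSymbol_lt (h : IsPowerCoeff g c) {m : ℕ} {z : Fin (m + 2) → ℂ}
    (hz : z ∈ polyDisk (m + 2)) : ‖z 0 * g (z 1)‖ < 1 := by
  rw [norm_mul]
  exact mul_lt_one_of_nonneg_of_lt_one_left (norm_nonneg _) (hz 0)
    (h.norm_le_one (mem_unitDisk.mpr (hz 1)))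

lemma mapsTo (h : IsPowerCoeff g c) (m : ℕ) :
    MapsTo (axisSymbol m g) (polyDisk (m + 2)) (polyDisk (m + 2)) := by
  intro z hz i
  rw [axisSymbol]
  rcases eq_or_ne i 0 with rfl | hi
  · simpa using h.norm_axisSymbol_lt hz
  · simp [hi]

lemma image_eq (h : IsPowerCoeff g c) (m : ℕ) :
    axisSymbol m g '' polyDisk (m + 2) = Pi.single (M := fun _ => ℂ) (0 : Fin (m + 2)) '' unitDisk := by
  apply Subset.antisymm
  · rintro _ ⟨z, hz, rfl⟩
    exact ⟨_, mem_unitDisk.mpr (h.norm_axisSymbol_lt hz), rfl⟩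
  · rintro _ ⟨w, hw, rfl⟩
    obtain ⟨t, ht, hwt⟩ := h.exists_norm_gt (mem_unitDisk.mp hw)
    have hg : 0 < ‖g t‖ := (norm_nonneg _).trans_lt hwt
    refine ⟨Fin.cons (w / g t) (Fin.cons t 0), fun i => ?_, ?_⟩
    · refine Fin.cases ?_ (fun i => Fin.cases ?_ (fun i => ?_) i) i
      · simpa [div_lt_one hg] using hwt
      · simpa using mem_unitDisk.mp ht
      · simp
    · simp [axisSymbol, div_mul_cancel₀ w (norm_pos_iff.mp hg)]

lemma differentiableOn (h : IsPowerCoeff g c) (m : ℕ) :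
    DifferentiableOn ℂ (axisSymbol m g) (polyDisk (m + 2)) := by
  have hg : DifferentiableOn ℂ (fun z : Fin (m + 2) → ℂ => g (z 1)) (polyDisk (m + 2)) :=
    h.diff.comp (by fun_prop) fun z hz => mem_unitDisk.mpr (hz 1)
  have h0 : DifferentiableOn ℂ (fun z : Fin (m + 2) → ℂ => z 0 * g (z 1)) (polyDisk (m + 2)) :=
    DifferentiableOn.mul (by fun_prop) hg
  rw [differentiableOn_pi]
  intro i
  rcases eq_or_ne i 0 with rfl | hi
  · simpa [axisSymbol] using h0
  · simp [axisSymbol, hi]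

lemma isCompOpPoly (h : IsPowerCoeff g c) {m : ℕ} {T : H2poly (m + 2) →L[ℂ] H2poly (m + 2)}
    (hT : ∀ a, IsWeighted c a (T a)) : IsCompOpPoly (axisSymbol m g) T := by
  intro a z hz
  have hz1 := mem_unitDisk.mpr (hz 1)
  have hinj := multiIndex_injective m
  set A : ℕ → ℂ := fun k => a (multiIndex m (k, 0)) with hA
  have hsum : Summable fun x : ℕ × ℕ => A x.1 * c x.1 x.2 * (z 0 ^ x.1 * z 1 ^ x.2) := by
    have hgeom := ((summable_geometric_of_lt_one (norm_nonneg _) (hz 0)).mul_of_nonneg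
      (summable_geometric_of_lt_one (norm_nonneg _) (hz 1)) (fun _ => by positivity)
      (fun _ => by positivity)).mul_left ‖a‖
    refine Summable.of_norm_bounded hgeom fun x => ?_
    rw [norm_mul, norm_mul, norm_mul, norm_pow, norm_pow, Complex.norm_real,
      Real.norm_of_nonneg (h.nonneg _ _)]
    refine mul_le_mul_of_nonneg_right ?_ (by positivity)
    exact (mul_le_of_le_one_right (norm_nonneg _) (h.le_one _ _)).trans
      (lp.norm_apply_le_norm two_ne_zero a _)
  have hleft : H2poly.eval (T a) z = ∑' k, A k * (z 0 * g (z 1)) ^ k := by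
    have h1 : ∀ x, T a (multiIndex m x) * ∏ i, z i ^ multiIndex m x i
        = A x.1 * c x.1 x.2 * (z 0 ^ x.1 * z 1 ^ x.2) := fun x => by
      rw [(hT a).1, prod_pow_multiIndex]
    have hr : ∀ k, HasSum (fun j => A k * c k j * (z 0 ^ k * z 1 ^ j))
        (A k * (z 0 * g (z 1)) ^ k) := fun k => by
      have h2 := (h.hasSum k (z 1) hz1).mul_left (A k * z 0 ^ k)
      rw [mul_assoc, ← mul_pow] at h2
      exact h2.congr_fun fun j => by ring
    rw [H2poly.eval, ← hinj.tsum_eq, tsum_congr h1]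
    · exact (hsum.hasSum.prod_fiberwise hr).tsum_eq.symm
    · intro β hβ
      by_contra hcon
      exact hβ (by simp [(hT a).2 β hcon])
  have hinj0 : Function.Injective fun k => multiIndex m (k, 0) :=
    fun _ _ h => congrArg Prod.fst (hinj h)
  rw [hleft, H2poly.eval, ← hinj0.tsum_eq]
  · refine tsum_congr fun k => ?_
    rw [prod_pow_multiIndex]
    simp [hA, axisSymbol]
  · intro β hβ
    refine ⟨β 0, ?_⟩
    ext i
    refine Fin.cases rfl (fun i => ?_) i
    have hne : axisSymbol m g z i.succ ^ β i.succ ≠ 0 :=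
      Finset.prod_ne_zero_iff.mp (right_ne_zero_of_mul hβ) _ (Finset.mem_univ _)
    have hzero : β i.succ = 0 := by
      by_contra hb
      exact hne (by simp [axisSymbol, hb])
    rw [hzero]
    refine Fin.cases ?_ (fun i => ?_) i <;> simp [multiIndex]

end IsPowerCoeff

lemma isPowerCoeff_choose :
    IsPowerCoeff (fun w => (1 + w) / 2) fun k j => (k.choose j : ℝ) / 2 ^ k := by
  have hz : ∀ k, ∀ j ∉ Finset.range (k + 1), k.choose j = 0 := fun k j hj =>
    Nat.choose_eq_zero_of_lt (by simpa using hj)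
  refine ⟨by fun_prop, fun k j => by positivity, fun k => ?_, fun k w _ => ?_⟩
  · have h : ∑ j ∈ Finset.range (k + 1), (k.choose j : ℝ) / 2 ^ k = 1 := by
      rw [← Finset.sum_div, ← Nat.cast_sum, Nat.sum_range_choose]
      simp
    rw [← h]
    exact hasSum_sum_of_ne_finset_zero fun j hj => by simp [hz k j hj]
  · have h : ∑ j ∈ Finset.range (k + 1), (((k.choose j : ℝ) / 2 ^ k : ℝ) : ℂ) * w ^ j
        = ((1 + w) / 2) ^ k := by
      rw [add_comm 1 w, div_pow, add_pow, Finset.sum_div]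
      refine Finset.sum_congr rfl fun j _ => ?_
      push_cast
      ring
    rw [← h]
    exact hasSum_sum_of_ne_finset_zero fun j hj => by simp [hz k j hj]

lemma tsum_choose_sq (k : ℕ) :
    ∑' j, ((k.choose j : ℝ) / 2 ^ k) ^ 2 = (k.centralBinom : ℝ) / 4 ^ k := by
  rw [tsum_eq_sum (s := Finset.range (k + 1)) fun j hj => by
    simp [Nat.choose_eq_zero_of_lt (show k < j by simpa using hj)]]
  rw [Nat.centralBinom, ← Nat.sum_range_choose_sq]
  push_cast
  rw [Finset.sum_div]
  refine Finset.sum_congr rfl fun j _ => ?_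
  rw [div_pow, ← pow_mul, mul_comm k 2, pow_mul]
  norm_num

lemma centralBinom_div_sq_le (k : ℕ) :
    ((k.centralBinom : ℝ) / 4 ^ k) ^ 2 ≤ 1 / (2 * k + 1) := by
  induction k with
  | zero => simp
  | succ k ih =>
    have h : ((k : ℝ) + 1) * (k + 1).centralBinom = 2 * (2 * k + 1) * k.centralBinom := by
      exact_mod_cast Nat.succ_mul_centralBinom_succ k
    have hr : ((k + 1).centralBinom : ℝ) / 4 ^ (k + 1)
        = (2 * k + 1) / (2 * (k + 1)) * (k.centralBinom / 4 ^ k) := by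
      rw [eq_div_of_mul_eq (by positivity) ((mul_comm _ _).trans h), pow_succ]
      field_simp
      ring
    rw [hr, mul_pow]
    refine (mul_le_mul_of_nonneg_left ih (by positivity)).trans ?_
    push_cast
    rw [div_pow, div_mul_div_comm, div_le_div_iff₀ (by positivity) (by positivity)]
    nlinarith [show (0 : ℝ) ≤ k from k.cast_nonneg]

lemma tendsto_centralBinom_div : Tendsto (fun k : ℕ => (k.centralBinom : ℝ) / 4 ^ k) atTop
    (𝓝 0) := by
  have h : Tendsto (fun k : ℕ => ((k.centralBinom : ℝ) / 4 ^ k) ^ 2) atTop (𝓝 0) := by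
    refine squeeze_zero (fun _ => by positivity)
      (fun k => (centralBinom_div_sq_le k).trans ?_) tendsto_one_div_add_atTop_nhds_zero_nat
    exact one_div_le_one_div_of_le (by positivity) (by linarith [show (0 : ℝ) ≤ k from k.cast_nonneg])
  have h' := h.sqrt
  rw [Real.sqrt_zero] at h'
  exact h'.congr fun k => Real.sqrt_sq (by positivity)

lemma le_centralBinom_div (k : ℕ) : 1 / (2 * ((k : ℝ) + 1)) ≤ (k.centralBinom : ℝ) / 4 ^ k := by
  rw [div_le_div_iff₀ (by positivity) (by positivity), one_mul]
  rcases k.eq_zero_or_pos with rfl | hk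
  · norm_num
  · have h : (4 : ℝ) ^ k ≤ 2 * k * k.centralBinom := by
      exact_mod_cast Nat.four_pow_le_two_mul_self_mul_centralBinom k hk
    nlinarith [show (0 : ℝ) ≤ k.centralBinom from Nat.cast_nonneg _]

lemma tendsto_one_of_inv_linear_le {s : ℝ} (hs : 0 < s) {a : ℕ → ℝ}
    (ha : ∀ n : ℕ, 1 / (2 * ((n : ℝ) + 1)) ≤ a n) (ha1 : ∀ n, a n ≤ 1) :
    Tendsto (fun n : ℕ => a n ^ (1 / ((n : ℝ) + 1) ^ s)) atTop (𝓝 1) := by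
  have hx : Tendsto (fun n : ℕ => (n : ℝ) + 1) atTop atTop :=
    tendsto_natCast_atTop_atTop.atTop_add tendsto_const_nhds
  have hlog : Tendsto (fun x : ℝ => -(Real.log 2 + Real.log x) / x ^ s) atTop (𝓝 0) := by
    have h1 := (isLittleO_log_rpow_atTop hs).tendsto_div_nhds_zero
    have h2 := (tendsto_const_nhds (x := Real.log 2)).div_atTop (tendsto_rpow_atTop hs)
    simpa [neg_div, add_div] using (h2.add h1).neg
  have hlow : Tendsto (fun n : ℕ => (1 / (2 * ((n : ℝ) + 1))) ^ (1 / ((n : ℝ) + 1) ^ s)) atTop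
      (𝓝 1) := by
    have h := (Real.continuous_exp.tendsto 0).comp (hlog.comp hx)
    rw [Real.exp_zero] at h
    refine h.congr fun n => ?_
    rw [Real.rpow_def_of_pos (by positivity), one_div, Real.log_inv,
      Real.log_mul (by norm_num) (by positivity)]
    simp [Function.comp_def, div_eq_mul_inv]
  refine tendsto_of_tendsto_of_tendsto_of_le_of_le hlow tendsto_const_nhds (fun n => ?_)
    fun n => ?_
  · exact Real.rpow_le_rpow (by positivity) (ha n) (by positivity)
  · exact Real.rpow_le_one (le_trans (by positivity) (ha n)) (ha1 n) (by positivity)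

lemma exists_compOp_slow (m : ℕ) {s : ℝ} (hs : 0 < s) :
    ∃ T : H2poly (m + 2) →L[ℂ] H2poly (m + 2),
      IsCompOpPoly (axisSymbol m fun w => (1 + w) / 2) T ∧ IsCompactOperator ⇑T ∧
      Tendsto (fun n : ℕ => approxNum (n + 1) T ^ (1 / ((n : ℝ) + 1) ^ s)) atTop (𝓝 1) := by
  have hσ := isPowerCoeff_choose.hasSum_sq
  have hσ1 : ∀ k, ∑' j, ((k.choose j : ℝ) / 2 ^ k) ^ 2 ≤ 1 := fun k =>
    isPowerCoeff_choose.tsum_sq_le (isPowerCoeff_choose.le_one k)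
  obtain ⟨T, hT⟩ := exists_weightedOp (m := m) hσ hσ1
  refine ⟨T, isPowerCoeff_choose.isCompOpPoly hT, isCompactOperator_of_weighted hσ ?_ hT,
    tendsto_one_of_inv_linear_le hs (fun n => le_approxNum_of_weighted hσ (fun k hk => ?_) hT)
      fun n => (approxNum_le (rank_truncate_lt T)).trans
        (norm_sub_truncate_le (n := n) hσ zero_le_one (fun k _ => by simpa using hσ1 k) hT)⟩
  · simpa only [tsum_choose_sq] using tendsto_centralBinom_div
  · rw [tsum_choose_sq]
    refine le_trans ?_ (le_centralBinom_div k)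
    have hk' : (k : ℝ) ≤ n := by exact_mod_cast hk
    have hk0 : (0 : ℝ) ≤ k := k.cast_nonneg
    rw [one_div, one_div, inv_pow]
    exact inv_anti₀ (by positivity) (by nlinarith)

section PowerSeries

variable {p : ℕ → ℝ}

lemma coeff_mk_pow_succ (p : ℕ → ℝ) (k j : ℕ) :
    PowerSeries.coeff j (PowerSeries.mk p ^ (k + 1)) =
      ∑ x ∈ Finset.HasAntidiagonal.antidiagonal j, p x.1 * PowerSeries.coeff x.2 (PowerSeries.mk p ^ k) := by
  simp [pow_succ', PowerSeries.coeff_mul]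

lemma coeff_mk_pow_nonneg (hp : ∀ j, 0 ≤ p j) (k j : ℕ) :
    0 ≤ PowerSeries.coeff j (PowerSeries.mk p ^ k) := by
  induction k generalizing j with
  | zero => rw [pow_zero, PowerSeries.coeff_one]; split_ifs <;> norm_num
  | succ k ih =>
    rw [coeff_mk_pow_succ]
    exact Finset.sum_nonneg fun x _ => mul_nonneg (hp _) (ih _)

lemma hasSum_coeff_mk_pow {w : ℂ} (hs : Summable fun j => ‖(p j : ℂ) * w ^ j‖)
    (k : ℕ) :
    (Summable fun j => ‖((PowerSeries.coeff j (PowerSeries.mk p ^ k) : ℝ) : ℂ) * w ^ j‖) ∧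
    HasSum (fun j => ((PowerSeries.coeff j (PowerSeries.mk p ^ k) : ℝ) : ℂ) * w ^ j)
      ((∑' j, (p j : ℂ) * w ^ j) ^ k) := by
  induction k with
  | zero =>
    have h0 : ∀ j ≠ 0, ((PowerSeries.coeff j (PowerSeries.mk p ^ 0) : ℝ) : ℂ) * w ^ j = 0 :=
      fun j hj => by simp [PowerSeries.coeff_one, hj]
    refine ⟨(hasSum_single 0 fun j hj => by rw [h0 j hj, norm_zero]).summable, ?_⟩
    simpa using hasSum_single 0 h0
  | succ k ih =>
    have hc : ∀ j, ((PowerSeries.coeff j (PowerSeries.mk p ^ (k + 1)) : ℝ) : ℂ) * w ^ j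
        = ∑ x ∈ Finset.HasAntidiagonal.antidiagonal j, ((p x.1 : ℂ) * w ^ x.1) *
          ((PowerSeries.coeff x.2 (PowerSeries.mk p ^ k) : ℝ) * w ^ x.2) := fun j => by
      rw [coeff_mk_pow_succ, Complex.ofReal_sum, Finset.sum_mul]
      refine Finset.sum_congr rfl fun x hx => ?_
      rw [← Finset.HasAntidiagonal.mem_antidiagonal.mp hx, pow_add]
      push_cast
      ring
    simp only [hc]
    have hn := summable_norm_sum_mul_antidiagonal_of_summable_norm hs ih.1
    refine ⟨hn, ?_⟩
    rw [pow_succ', ← ih.2.tsum_eq, tsum_mul_tsum_eq_tsum_sum_antidiagonal_of_summable_norm hs ih.1]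
    exact hn.of_norm.hasSum

lemma isPowerCoeff_mk (hp : ∀ j, 0 ≤ p j) (h1 : HasSum p 1) :
    IsPowerCoeff (fun w => ∑' j, (p j : ℂ) * w ^ j)
      fun k j => PowerSeries.coeff j (PowerSeries.mk p ^ k) := by
  have hb : ∀ j, ∀ w : ℂ, ‖w‖ ≤ 1 → ‖(p j : ℂ) * w ^ j‖ ≤ p j := fun j w hw => by
    rw [norm_mul, Complex.norm_real, Real.norm_of_nonneg (hp j), norm_pow]
    exact mul_le_of_le_one_right (hp j) (pow_le_one₀ (norm_nonneg _) hw)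
  have hs : ∀ w : ℂ, ‖w‖ ≤ 1 → Summable fun j => ‖(p j : ℂ) * w ^ j‖ := fun w hw =>
    h1.summable.of_nonneg_of_le (fun _ => norm_nonneg _) fun j => hb j w hw
  refine ⟨?_, coeff_mk_pow_nonneg hp, fun k => ?_, fun k w hw =>
    (hasSum_coeff_mk_pow (hs w (mem_unitDisk.mp hw).le) k).2⟩
  · exact Complex.differentiableOn_tsum_of_summable_norm h1.summable (fun j => by fun_prop)
      Metric.isOpen_ball fun j w hw => hb j w (mem_unitDisk.mp hw).le
  · have h := (hasSum_coeff_mk_pow (hs 1 (by simp)) k).2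
    simp only [one_pow, mul_one] at h
    rw [← Complex.ofReal_tsum, h1.tsum_eq, Complex.ofReal_one, one_pow] at h
    simpa using Complex.hasSum_re h

/-- The mass of a single point under a convolution power is small when the mass of `p`
beyond `M` is spread out. -/
lemma coeff_mk_pow_le (hp : ∀ j, 0 ≤ p j) (h1 : HasSum p 1) {M : ℕ} {ε : ℝ} (hε : 0 ≤ ε)
    (hM : ∀ j, M ≤ j → p j ≤ ε) (k j : ℕ) :
    PowerSeries.coeff j (PowerSeries.mk p ^ k) ≤ (∑ i ∈ Finset.range M, p i) ^ k + k * ε := by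
  set q := ∑ i ∈ Finset.range M, p i with hq
  have hq0 : 0 ≤ q := Finset.sum_nonneg fun i _ => hp i
  have hq1 : q ≤ 1 := sum_le_hasSum _ (fun i _ => hp i) h1
  induction k generalizing j with
  | zero => rw [pow_zero, PowerSeries.coeff_one]; split_ifs <;> simp
  | succ k ih =>
    have hnn := coeff_mk_pow_nonneg hp k
    have hsum := (isPowerCoeff_mk hp h1).sum_one k
    rw [coeff_mk_pow_succ, Finset.Nat.sum_antidiagonal_eq_sum_range_succ
      (fun a b => p a * PowerSeries.coeff b (PowerSeries.mk p ^ k)),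
      ← Finset.sum_filter_add_sum_filter_not _ (fun a => a < M)]
    have hlow : ∑ a ∈ (Finset.range j.succ).filter (fun a => a < M),
        p a * PowerSeries.coeff (j - a) (PowerSeries.mk p ^ k) ≤ q * (q ^ k + k * ε) := by
      rw [hq, Finset.sum_mul]
      refine (Finset.sum_le_sum fun a _ => mul_le_mul_of_nonneg_left (ih (j - a)) (hp a)).trans ?_
      refine Finset.sum_le_sum_of_subset_of_nonneg (fun a ha => ?_) fun a _ _ =>
        mul_nonneg (hp a) (by positivity)
      simpa using (Finset.mem_filter.mp ha).2
    have hhigh : ∑ a ∈ (Finset.range j.succ).filter (fun a => ¬ a < M),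
        p a * PowerSeries.coeff (j - a) (PowerSeries.mk p ^ k) ≤ ε := by
      calc _ ≤ ∑ a ∈ (Finset.range j.succ).filter (fun a => ¬ a < M),
            ε * PowerSeries.coeff (j - a) (PowerSeries.mk p ^ k) :=
            Finset.sum_le_sum fun a ha => mul_le_mul_of_nonneg_right
              (hM a (not_lt.mp (Finset.mem_filter.mp ha).2)) (hnn _)
        _ ≤ ∑ a ∈ Finset.range (j + 1),
            ε * PowerSeries.coeff (j + 1 - 1 - a) (PowerSeries.mk p ^ k) :=
            Finset.sum_le_sum_of_subset_of_nonneg (Finset.filter_subset _ _)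
              fun a _ _ => mul_nonneg hε (hnn _)
        _ = ε * ∑ a ∈ Finset.range (j + 1), PowerSeries.coeff a (PowerSeries.mk p ^ k) := by
            rw [← Finset.mul_sum, Finset.sum_range_reflect
              (fun a => PowerSeries.coeff a (PowerSeries.mk p ^ k))]
        _ ≤ ε := mul_le_of_le_one_right hε (sum_le_hasSum _ (fun a _ => hnn a) hsum)
    have hk : q * (k * ε) ≤ k * ε := mul_le_of_le_one_left (by positivity) hq1
    push_cast
    rw [pow_succ']
    linarith

end PowerSeries

/-- The tail of a probability distribution on `ℕ` decaying like `(log n)^(-1/2)`. -/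
def logTail (n : ℕ) : ℝ := (√(1 + Real.log (n + 1)))⁻¹

lemma log_nat_succ_nonneg (n : ℕ) : 0 ≤ Real.log ((n : ℝ) + 1) :=
  Real.log_nonneg (by linarith [show (0 : ℝ) ≤ n from n.cast_nonneg])

lemma logTail_succ_le (n : ℕ) : logTail (n + 1) ≤ logTail n := by
  have h := log_nat_succ_nonneg n
  refine inv_anti₀ (by positivity) (Real.sqrt_le_sqrt ?_)
  push_cast
  gcongr
  linarith

lemma logTail_sub_le (n : ℕ) : logTail n - logTail (n + 1) ≤ 1 / (n + 1) := by
  have h0 := log_nat_succ_nonneg n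
  have h1 : Real.log ((n : ℝ) + 1 + 1) - Real.log ((n : ℝ) + 1) ≤ 1 / (n + 1) := by
    rw [← Real.log_div (by positivity) (by positivity)]
    refine (Real.log_le_sub_one_of_pos (by positivity)).trans (le_of_eq ?_)
    field_simp
    ring
  have h2 : Real.log ((n : ℝ) + 1) ≤ Real.log ((n : ℝ) + 1 + 1) :=
    Real.log_le_log (by positivity) (by linarith)
  set u := √(1 + Real.log ((n : ℝ) + 1)) with hu
  set v := √(1 + Real.log ((n : ℝ) + 1 + 1)) with hv
  have hu1 : 1 ≤ u := Real.one_le_sqrt.mpr (by linarith)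
  have huv : u ≤ v := Real.sqrt_le_sqrt (by linarith)
  have hu2 : u ^ 2 = 1 + Real.log ((n : ℝ) + 1) := Real.sq_sqrt (by linarith)
  have hv2 : v ^ 2 = 1 + Real.log ((n : ℝ) + 1 + 1) := Real.sq_sqrt (by linarith)
  refine le_trans ?_ h1
  have e : logTail n - logTail (n + 1) = u⁻¹ - v⁻¹ := by simp [logTail, hu, hv]
  have hu0 : 0 < u := by linarith
  have hv0 : 0 < v := by linarith
  rw [e, inv_sub_inv hu0.ne' hv0.ne', show Real.log ((n : ℝ) + 1 + 1) - Real.log ((n : ℝ) + 1)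
    = v ^ 2 - u ^ 2 by rw [hu2, hv2]; ring, div_le_iff₀ (by positivity)]
  have : 1 ≤ (v + u) * (u * v) := by nlinarith [mul_le_mul hu1 (hu1.trans huv) zero_le_one hu0.le]
  nlinarith [mul_le_mul_of_nonneg_left this (sub_nonneg.mpr huv)]

lemma tendsto_logTail : Tendsto logTail atTop (𝓝 0) := by
  refine tendsto_inv_atTop_zero.comp (Real.tendsto_sqrt_atTop.comp ?_)
  refine tendsto_const_nhds.add_atTop (Real.tendsto_log_atTop.comp ?_)
  exact tendsto_natCast_atTop_atTop.atTop_add tendsto_const_nhds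

lemma sum_logTail_sub (M : ℕ) :
    ∑ i ∈ Finset.range M, (logTail i - logTail (i + 1)) = 1 - logTail M := by
  rw [Finset.sum_range_sub']
  simp [logTail]

lemma hasSum_logTail_sub : HasSum (fun n => logTail n - logTail (n + 1)) 1 := by
  rw [hasSum_iff_tendsto_nat_of_nonneg fun n => sub_nonneg.mpr (logTail_succ_le n)]
  simp only [sum_logTail_sub]
  simpa using tendsto_logTail.const_sub 1

lemma coeff_logTail_pow_le {A : ℝ} (hA : 1 ≤ A) {n : ℕ} (hn : 45 * A ^ 3 ≤ √n) (j : ℕ) :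
    PowerSeries.coeff j (PowerSeries.mk (fun i => logTail i - logTail (i + 1)) ^ n)
      ≤ Real.exp (-(2 * A * √n)) := by
  set x := √(n : ℝ) with hx
  have hxn : x ^ 2 = n := Real.sq_sqrt n.cast_nonneg
  have hA3 : 1 ≤ A ^ 3 := one_le_pow₀ hA
  have hx45 : 45 ≤ x := by linarith
  obtain ⟨M, hM⟩ : ∃ M : ℕ, M + 1 = ⌈Real.exp (3 * A * x)⌉₊ :=
    ⟨_, Nat.sub_add_cancel (Nat.one_le_ceil_iff.mpr (Real.exp_pos _))⟩
  have hM1 : Real.exp (3 * A * x) ≤ (M : ℝ) + 1 := by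
    exact_mod_cast hM ▸ Nat.le_ceil (Real.exp (3 * A * x))
  have hM2 : (M : ℝ) + 1 ≤ Real.exp (3 * A * x + 1) := by
    have h1 : (M : ℝ) + 1 < Real.exp (3 * A * x) + 1 := by
      exact_mod_cast hM ▸ Nat.ceil_lt_add_one (Real.exp_pos (3 * A * x)).le
    have h2 : 1 ≤ Real.exp (3 * A * x) := Real.one_le_exp (by positivity)
    rw [Real.exp_add]
    nlinarith [Real.add_one_le_exp 1]
  have hlog : Real.log ((M : ℝ) + 1) ≤ 3 * A * x + 1 :=
    (Real.log_le_iff_le_exp (by positivity)).mpr hM2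
  have htail : (√(3 * A * x + 2))⁻¹ ≤ logTail M :=
    inv_anti₀ (Real.sqrt_pos.mpr (by linarith [log_nat_succ_nonneg M]))
      (Real.sqrt_le_sqrt (by linarith))
  have hfirst : (1 - logTail M) ^ n ≤ Real.exp (-(2 * A * x)) / 2 := by
    have hle : 0 ≤ 1 - logTail M := by
      rw [← sum_logTail_sub]
      exact Finset.sum_nonneg fun i _ => sub_nonneg.mpr (logTail_succ_le i)
    have hexp : (1 - logTail M) ^ n ≤ Real.exp (-(n * logTail M)) := by
      rw [← mul_neg, Real.exp_nat_mul]
      exact pow_le_pow_left₀ hle (by linarith [Real.add_one_le_exp (-logTail M)]) n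
    have hkey : 2 * A * x + 1 ≤ n * logTail M := by
      refine le_trans ?_ (mul_le_mul_of_nonneg_left htail n.cast_nonneg)
      rw [← div_eq_mul_inv, le_div_iff₀ (Real.sqrt_pos.mpr (by positivity)), ← hxn]
      have hAx : 45 ≤ A * x := by nlinarith
      have h5 : √(3 * A * x + 2) ≤ √(5 * (A * x)) := Real.sqrt_le_sqrt (by linarith)
      have hsq : (3 * (A * x) * √(5 * (A * x))) ^ 2 ≤ (x ^ 2) ^ 2 := by
        rw [mul_pow, Real.sq_sqrt (by positivity)]
        have : 45 * A ^ 3 * x ^ 3 ≤ x * x ^ 3 := mul_le_mul_of_nonneg_right hn (by positivity)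
        nlinarith
      have := pow_le_pow_iff_left₀ (by positivity) (by positivity) two_ne_zero |>.mp hsq
      refine le_trans ?_ this
      exact mul_le_mul (by linarith) h5 (Real.sqrt_nonneg _) (by positivity)
    refine hexp.trans ?_
    calc Real.exp (-(n * logTail M)) ≤ Real.exp (-(2 * A * x) + -1) :=
          Real.exp_le_exp.mpr (by linarith)
      _ ≤ _ := by
        rw [Real.exp_add, div_eq_mul_inv]
        refine mul_le_mul_of_nonneg_left ?_ (Real.exp_pos _).le
        rw [Real.exp_neg]
        exact inv_anti₀ two_pos (by linarith [Real.add_one_le_exp 1])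
  have hsecond : n * (1 / ((M : ℝ) + 1)) ≤ Real.exp (-(2 * A * x)) / 2 := by
    have h1 : 1 / ((M : ℝ) + 1) ≤ Real.exp (-(3 * A * x)) := by
      rw [Real.exp_neg, one_div]
      exact inv_anti₀ (Real.exp_pos _) hM1
    have h2 : 2 * x ^ 2 ≤ Real.exp (A * x) := by
      have hq := Real.pow_div_factorial_le_exp x (by linarith) 3
      have : Real.exp x ≤ Real.exp (A * x) := Real.exp_le_exp.mpr (by nlinarith)
      norm_num [Nat.factorial] at hq
      nlinarith [mul_le_mul_of_nonneg_right hx45 (sq_nonneg x)]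
    have h3 : Real.exp (A * x) * Real.exp (-(3 * A * x)) = Real.exp (-(2 * A * x)) := by
      rw [← Real.exp_add]
      ring_nf
    rw [← hxn]
    nlinarith [mul_le_mul_of_nonneg_left h1 (sq_nonneg x),
      mul_le_mul_of_nonneg_right h2 (Real.exp_pos (-(3 * A * x))).le]
  have h := coeff_mk_pow_le (fun i => sub_nonneg.mpr (logTail_succ_le i)) hasSum_logTail_sub
    (M := M) (ε := 1 / ((M : ℝ) + 1)) (by positivity) (fun i hi => (logTail_sub_le i).trans
      (one_div_le_one_div_of_le (by positivity)
        (by have : (M : ℝ) ≤ i := by exact_mod_cast hi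
            linarith))) n j
  rw [sum_logTail_sub] at h
  linarith

lemma isPowerCoeff_logTail :
    IsPowerCoeff (fun w => ∑' j, ((logTail j - logTail (j + 1) : ℝ) : ℂ) * w ^ j)
      fun k j => PowerSeries.coeff j
        (PowerSeries.mk (fun i => logTail i - logTail (i + 1)) ^ k) :=
  isPowerCoeff_mk (fun i => sub_nonneg.mpr (logTail_succ_le i)) hasSum_logTail_sub

lemma tendsto_zero_of_le_exp {s : ℝ} (hs : s ≤ 1 / 2) {a : ℕ → ℝ} (ha0 : ∀ n, 0 ≤ a n)
    (ha : ∀ A : ℝ, 1 ≤ A → ∀ᶠ n : ℕ in atTop, a n ≤ Real.exp (-(A * √n))) :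
    Tendsto (fun n : ℕ => a n ^ (1 / ((n : ℝ) + 1) ^ s)) atTop (𝓝 0) := by
  rw [tendsto_order]
  refine ⟨fun r hr => Eventually.of_forall fun n => hr.trans_le (Real.rpow_nonneg (ha0 n) _),
    fun ε hε => ?_⟩
  obtain ⟨A, hA1, hA⟩ : ∃ A : ℝ, 1 ≤ A ∧ Real.exp (-(A / 2)) < ε := by
    have h : Tendsto (fun A : ℝ => Real.exp (-(A / 2))) atTop (𝓝 0) :=
      Real.tendsto_exp_neg_atTop_nhds_zero.comp (tendsto_id.atTop_div_const two_pos)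
    exact ((eventually_ge_atTop 1).and (h.eventually (gt_mem_nhds hε))).exists
  filter_upwards [ha A hA1, eventually_ge_atTop 1] with n hn hn1
  have hn1' : (1 : ℝ) ≤ n := by exact_mod_cast hn1
  refine lt_of_le_of_lt ?_ hA
  calc a n ^ (1 / ((n : ℝ) + 1) ^ s)
      ≤ Real.exp (-(A * √n)) ^ (1 / ((n : ℝ) + 1) ^ s) :=
        Real.rpow_le_rpow (ha0 n) hn (by positivity)
    _ = Real.exp (-(A * (√n / ((n : ℝ) + 1) ^ s))) := by
        rw [← Real.exp_mul]
        ring_nf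
    _ ≤ _ := by
        have hpow : ((n : ℝ) + 1) ^ s ≤ 2 * √n := by
          calc ((n : ℝ) + 1) ^ s ≤ ((n : ℝ) + 1) ^ (1 / 2 : ℝ) :=
                Real.rpow_le_rpow_of_exponent_le (by linarith) hs
            _ = √((n : ℝ) + 1) := (Real.sqrt_eq_rpow _).symm
            _ ≤ √(2 ^ 2 * n) := Real.sqrt_le_sqrt (by linarith)
            _ = 2 * √n := by rw [Real.sqrt_mul (by positivity), Real.sqrt_sq two_pos.le]
        have hpos : 0 < ((n : ℝ) + 1) ^ s := by positivity
        have hhalf : 1 / 2 ≤ √n / ((n : ℝ) + 1) ^ s := by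
          rw [le_div_iff₀ hpos]
          linarith
        refine Real.exp_le_exp.mpr ?_
        nlinarith

lemma exists_compOp_fast (m : ℕ) {s : ℝ} (hs : s ≤ 1 / 2) :
    ∃ T : H2poly (m + 2) →L[ℂ] H2poly (m + 2),
      IsCompOpPoly (axisSymbol m
        fun w => ∑' j, ((logTail j - logTail (j + 1) : ℝ) : ℂ) * w ^ j) T ∧
      IsCompactOperator ⇑T ∧
      Tendsto (fun n : ℕ => approxNum (n + 1) T ^ (1 / ((n : ℝ) + 1) ^ s)) atTop (𝓝 0) := by
  have hσ := isPowerCoeff_logTail.hasSum_sq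
  obtain ⟨T, hT⟩ := exists_weightedOp (m := m) hσ fun k =>
    isPowerCoeff_logTail.tsum_sq_le (isPowerCoeff_logTail.le_one k)
  have hsqrt : Tendsto (fun n : ℕ => √(n : ℝ)) atTop atTop :=
    Real.tendsto_sqrt_atTop.comp tendsto_natCast_atTop_atTop
  have hbound : ∀ A : ℝ, 1 ≤ A → ∀ n : ℕ, 45 * A ^ 3 ≤ √n →
      ∑' j, (PowerSeries.coeff j
        (PowerSeries.mk (fun i => logTail i - logTail (i + 1)) ^ n)) ^ 2
        ≤ Real.exp (-(2 * A * √n)) := fun A hA n hn =>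
    isPowerCoeff_logTail.tsum_sq_le (coeff_logTail_pow_le hA hn)
  refine ⟨T, isPowerCoeff_logTail.isCompOpPoly hT, isCompactOperator_of_weighted hσ ?_ hT,
    tendsto_zero_of_le_exp hs (fun n => approxNum_nonneg _ _) fun A hA => ?_⟩
  · refine squeeze_zero' (Eventually.of_forall fun n => tsum_nonneg fun _ => by positivity)
      ((hsqrt.eventually_ge_atTop _).mono (hbound 1 le_rfl)) ?_
    exact Real.tendsto_exp_neg_atTop_nhds_zero.comp (hsqrt.const_mul_atTop (by norm_num))
  · filter_upwards [hsqrt.eventually_ge_atTop (45 * A ^ 3)] with n hn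
    refine (approxNum_le (rank_truncate_lt T)).trans
      (norm_sub_truncate_le (n := n) hσ (Real.exp_pos _).le (fun k hk => ?_) hT)
    have hnk : √(n : ℝ) ≤ √k := Real.sqrt_le_sqrt (by exact_mod_cast hk)
    refine (hbound A hA k (hn.trans hnk)).trans ?_
    rw [← Real.exp_nat_mul]
    refine Real.exp_le_exp.mpr ?_
    push_cast
    nlinarith

/-- for `N ≥ 2` there are analytic `Φ₁, Φ₂ : 𝔻^N → 𝔻^N` with the same
image such that `C_{Φ₁}` is compact on `H²(𝔻^N)` with `β_N(C_{Φ₁}) = 1`, while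
`C_{Φ₂}` is compact with `β_N(C_{Φ₂}) = 0`. -/
theorem stmt_17 (N : ℕ) (hN : 2 ≤ N) :
    ∃ Φ₁ Φ₂ : (Fin N → ℂ) → (Fin N → ℂ),
      Set.MapsTo Φ₁ (polyDisk N) (polyDisk N) ∧ Set.MapsTo Φ₂ (polyDisk N) (polyDisk N) ∧
      DifferentiableOn ℂ Φ₁ (polyDisk N) ∧ DifferentiableOn ℂ Φ₂ (polyDisk N) ∧
      Φ₁ '' polyDisk N = Φ₂ '' polyDisk N ∧
      (∃ T₁ : H2poly N →L[ℂ] H2poly N, IsCompOpPoly Φ₁ T₁ ∧ IsCompactOperator ⇑T₁ ∧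
        Filter.Tendsto
          (fun n : ℕ => approxNum (n + 1) T₁ ^ (1 / ((n : ℝ) + 1) ^ (1 / (N : ℝ))))
          Filter.atTop (nhds 1)) ∧
      ∃ T₂ : H2poly N →L[ℂ] H2poly N, IsCompOpPoly Φ₂ T₂ ∧ IsCompactOperator ⇑T₂ ∧
        Filter.Tendsto
          (fun n : ℕ => approxNum (n + 1) T₂ ^ (1 / ((n : ℝ) + 1) ^ (1 / (N : ℝ))))
          Filter.atTop (nhds 0) := by
  obtain ⟨m, rfl⟩ := Nat.exists_eq_add_of_le' hN
  have hs : 1 / ((m + 2 : ℕ) : ℝ) ≤ 1 / 2 :=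
    one_div_le_one_div_of_le two_pos (by push_cast; linarith [show (0 : ℝ) ≤ m from m.cast_nonneg])
  have h₁ := isPowerCoeff_choose
  have h₂ := isPowerCoeff_logTail
  exact ⟨_, _, h₁.mapsTo m, h₂.mapsTo m, h₁.differentiableOn m, h₂.differentiableOn m,
    (h₁.image_eq m).trans (h₂.image_eq m).symm, exists_compOp_slow m (by positivity),
    exists_compOp_fast m hs⟩

end
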